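/- Let k_p, k_q ∈ ℝ³ have positive entries, let Λ₁p = diag(γ_{p,1},γ_{p,2},γ_{p,3}) and Λ₁q = diag(γ_{q,1},γ_{q,2},γ_{q,3}) with all γ's positive, let Λ₂p, Λ₂q be positive definite 3×3 matrices, and let ρ_p, ρ_q ≥ 0, ε_p, ε_q > 0. Let z_p, z_{2p}, z_q, z_{2q} : ℝ → ℝ³ be differentiable and η_p, η_q : ℝ → ℝ³ continuous with ‖η_p(t)‖ ≤ ρ_p and ‖η_q(t)‖ ≤ ρ_q for all t ≥ 0, and suppose for all t ≥ 0: ż_p = z_{2p} − Λ₁p z_p, ż_{2p} = −D_p z_p − Λ₂p z_{2p} − ρ_p·sat(z_{2p}, ε_p) + η_p, where D_p(t) is diagonal with i-th entry 1/(k_{p,i}² − z_{p,i}(t)²), and analogously ż_q = z_{2q} − Λ₁q z_q, ż_{2q} = −D_q z_q − Λ₂q z_{2q} − ρ_q·sat(z_{2q}, ε_q) + η_q with D_q(t) diagonal with entries 1/(k_{q,i}² − z_{q,i}(t)²). If |z_{p,i}(0)| < k_{p,i} and |z_{q,i}(0)| < k_{q,i} for i = 1,2,3, then |z_{p,i}(t)|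 < k_{p,i} and |z_{q,i}(t)| < k_{q,i} for i = 1,2,3 and all t ≥ 0. -/

import Mathlib

open Matrix

/-- The saturation function: `sat(x, ε) = x/‖x‖` if `‖x‖ ≥ ε` and `x/ε` if `‖x‖ < ε`. -/
noncomputable def sat (x : EuclideanSpace ℝ (Fin 3)) (ε : ℝ) : EuclideanSpace ℝ (Fin 3) :=
  if ε ≤ ‖x‖ then ‖x‖⁻¹ • x else ε⁻¹ • x

theorem inner_toEuclideanLin_nonneg {n : Type*} [Fintype n] [DecidableEq n]
    {A : Matrix n n ℝ} (hA : A.PosSemidef) (x : EuclideanSpace ℝ n) :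
    0 ≤ inner ℝ x (Matrix.toEuclideanLin A x) := by
  have h := hA.dotProduct_mulVec_nonneg x.ofLp
  simpa [PiLp.inner_apply, dotProduct, mul_comm, Matrix.toLpLin_apply] using h

/-- The robust term dominates any disturbance of norm at most `ρ`, up to an error `ρ * ε`. -/
theorem inner_sub_smul_sat_le {ρ ε : ℝ} (hρ : 0 ≤ ρ) (hε : 0 < ε)
    {w v : EuclideanSpace ℝ (Fin 3)} (hv : ‖v‖ ≤ ρ) :
    inner ℝ w (v - ρ • sat w ε) ≤ ρ * ε := by
  have h1 : inner ℝ w v ≤ ‖w‖ * ρ :=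
    (real_inner_le_norm w v).trans (mul_le_mul_of_nonneg_left hv (norm_nonneg w))
  rw [inner_sub_right, inner_smul_right]
  unfold sat
  split_ifs with h
  · have hw : ‖w‖ ≠ 0 := (hε.trans_le h).ne'
    have h2 : ‖w‖⁻¹ * ‖w‖ ^ 2 = ‖w‖ := by field_simp
    rw [inner_smul_right, real_inner_self_eq_norm_sq, h2]
    nlinarith [mul_nonneg hρ hε.le]
  · rw [inner_smul_right, real_inner_self_eq_norm_sq]
    have h2 : 0 ≤ ρ * (ε⁻¹ * ‖w‖ ^ 2) := by positivity
    nlinarith [mul_le_mul_of_nonneg_left (not_le.mp h).le hρ]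

/-- The barrier Lyapunov function with constraint vector `k`. -/
noncomputable def barrierLyapunov (k : Fin 3 → ℝ) (z w : EuclideanSpace ℝ (Fin 3)) : ℝ :=
  ∑ i, (1 / 2) * (Real.log (k i ^ 2) - Real.log (k i ^ 2 - z i ^ 2)) + (1 / 2) * ‖w‖ ^ 2

theorem exp_neg_two_mul_barrierLyapunov_le {k : Fin 3 → ℝ} {z w : EuclideanSpace ℝ (Fin 3)}
    (hz : ∀ i, |z i| < k i) {M : ℝ} (hM : barrierLyapunov k z w ≤ M) (i : Fin 3) :
    k i ^ 2 * Real.exp (-(2 * M)) ≤ k i ^ 2 - z i ^ 2 := by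
  have hpos : ∀ j, 0 < k j ^ 2 - z j ^ 2 := fun j =>
    sub_pos.mpr (sq_lt_sq.mpr ((hz j).trans_le (le_abs_self _)))
  have hk : 0 < k i := (abs_nonneg _).trans_lt (hz i)
  have hterm : ∀ j ∈ Finset.univ,
      0 ≤ (1 / 2) * (Real.log (k j ^ 2) - Real.log (k j ^ 2 - z j ^ 2)) := fun j _ => by
    have := Real.log_le_log (hpos j) (sub_le_self (k j ^ 2) (sq_nonneg (z j)))
    linarith
  have hle := Finset.single_le_sum hterm (Finset.mem_univ i)
  have hw : 0 ≤ (1 / 2) * ‖w‖ ^ 2 := by positivity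
  unfold barrierLyapunov at hM
  rw [← Real.log_le_log_iff (by positivity) (hpos i),
    Real.log_mul (by positivity) (Real.exp_ne_zero _), Real.log_exp]
  linarith

theorem hasDerivAt_barrierLyapunov {k : Fin 3 → ℝ} {z w : ℝ → EuclideanSpace ℝ (Fin 3)}
    {z' w' : EuclideanSpace ℝ (Fin 3)} {t : ℝ} (hz : HasDerivAt z z' t) (hw : HasDerivAt w w' t)
    (hk : ∀ i, |z t i| < k i) :
    HasDerivAt (fun s => barrierLyapunov k (z s) (w s))
      (∑ i, z t i * z' i / (k i ^ 2 - z t i ^ 2) + inner ℝ (w t) w') t := by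
  have hpos : ∀ j, k j ^ 2 - z t j ^ 2 ≠ 0 := fun j =>
    (sub_pos.mpr (sq_lt_sq.mpr ((hk j).trans_le (le_abs_self _)))).ne'
  unfold barrierLyapunov
  have hzi : ∀ i, HasDerivAt (fun s => z s i) (z' i) t := fun i =>
    (EuclideanSpace.proj (𝕜 := ℝ) i).hasFDerivAt.comp_hasDerivAt t hz
  refine (HasDerivAt.fun_sum fun i _ => ?_).add ?_
  · have h := ((((hzi i).pow 2).const_sub (k i ^ 2)).log (hpos i)).const_sub
      (Real.log (k i ^ 2)) |>.const_mul (1 / 2)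
    refine h.congr_deriv ?_
    simp only [Pi.pow_apply]
    push_cast
    ring
  · exact (hw.norm_sq.const_mul (1 / 2)).congr_deriv (by ring)

/-- A single subsystem stays within its constraints. -/
theorem abs_lt_of_closedLoop {k γ : Fin 3 → ℝ} (hγ : ∀ i, 0 ≤ γ i)
    {A : Matrix (Fin 3) (Fin 3) ℝ} (hA : A.PosSemidef) {ρ ε : ℝ} (hρ : 0 ≤ ρ) (hε : 0 < ε)
    {z w η : ℝ → EuclideanSpace ℝ (Fin 3)} (hη : ∀ t, 0 ≤ t → ‖η t‖ ≤ ρ)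
    (hz : Differentiable ℝ z) (hw : Differentiable ℝ w)
    (hzeq : ∀ t, 0 ≤ t → deriv z t = w t - Matrix.toEuclideanLin (Matrix.diagonal γ) (z t))
    (hweq : ∀ t, 0 ≤ t → deriv w t =
      -(Matrix.toEuclideanLin (Matrix.diagonal fun i => 1 / (k i ^ 2 - z t i ^ 2)) (z t))
      - Matrix.toEuclideanLin A (w t) - ρ • sat (w t) ε + η t)
    (h0 : ∀ i, |z 0 i| < k i) {t : ℝ} (ht : 0 ≤ t) (i : Fin 3) : |z t i| < k i := by
  have hzc : ∀ i, Continuous fun s => z s i := fun i => by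
    have := hz.continuous
    fun_prop
  have hderiv : ∀ s, 0 ≤ s → (∀ i, |z s i| < k i) →
      ∃ d ≤ ρ * ε, HasDerivAt (fun s => barrierLyapunov k (z s) (w s)) d s := by
    intro s hs hks
    refine ⟨_, ?_, hasDerivAt_barrierLyapunov (hz s).hasDerivAt (hw s).hasDerivAt hks⟩
    have hpos : ∀ j, 0 < k j ^ 2 - z s j ^ 2 := fun j =>
      sub_pos.mpr (sq_lt_sq.mpr ((hks j).trans_le (le_abs_self _)))
    have hsum : ∑ i, z s i * deriv z s i / (k i ^ 2 - z s i ^ 2) ≤ inner ℝ (w s)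
        (Matrix.toEuclideanLin (Matrix.diagonal fun i => 1 / (k i ^ 2 - z s i ^ 2)) (z s)) := by
      rw [hzeq s hs, PiLp.inner_apply]
      refine Finset.sum_le_sum fun i _ => ?_
      have hnn : 0 ≤ γ i * z s i ^ 2 / (k i ^ 2 - z s i ^ 2) :=
        div_nonneg (mul_nonneg (hγ i) (sq_nonneg _)) (hpos i).le
      simp only [Matrix.toLpLin_apply, Matrix.mulVec_diagonal, PiLp.sub_apply, RCLike.inner_apply,
        conj_trivial]
      have e : z s i * (w s i - γ i * z s i) / (k i ^ 2 - z s i ^ 2) =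
          1 / (k i ^ 2 - z s i ^ 2) * z s i * w s i - γ i * z s i ^ 2 / (k i ^ 2 - z s i ^ 2) := by
        ring
      rw [e]
      linarith
    have hsat := inner_sub_smul_sat_le hρ hε (w := w s) (hη s hs)
    have hAw := inner_toEuclideanLin_nonneg hA (w s)
    rw [inner_sub_right] at hsat
    rw [hweq s hs, inner_add_right, inner_sub_right, inner_sub_right, inner_neg_right]
    linarith
  by_contra hcon
  set S : Set ℝ := {s | 0 ≤ s ∧ ∃ i, k i ≤ |z s i|} with hS
  have hSc : IsClosed S := by
    have : S = Set.Ici 0 ∩ ⋃ i, {s | k i ≤ |z s i|} := by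
      ext s
      simp [hS]
    rw [this]
    exact isClosed_Ici.inter
      (isClosed_iUnion_of_finite fun i => isClosed_le continuous_const (hzc i).abs)
  have hSb : BddBelow S := ⟨0, fun s hs => hs.1⟩
  have hTS : sInf S ∈ S := hSc.csInf_mem ⟨t, ht, i, not_lt.mp hcon⟩ hSb
  set T := sInf S
  have hbefore : ∀ s ∈ Set.Ico 0 T, ∀ i, |z s i| < k i := by
    intro s hs i
    by_contra h
    exact (csInf_le hSb ⟨hs.1, i, not_lt.mp h⟩).not_gt hs.2
  obtain ⟨hT0, j, hj⟩ := hTS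
  have hTpos : 0 < T := hT0.lt_of_ne fun h => by
    rw [← h] at hj
    exact (h0 j).not_ge hj
  set M := barrierLyapunov k (z 0) (w 0) + ρ * ε * T
  have hbound : ∀ s ∈ Set.Ico 0 T, barrierLyapunov k (z s) (w s) ≤ M := by
    intro s hs
    have hD : ∀ r ∈ Set.Ico 0 T, ∃ d ≤ ρ * ε,
        HasDerivAt (fun s => barrierLyapunov k (z s) (w s)) d r :=
      fun r hr => hderiv r hr.1 (hbefore r hr)
    have h := (convex_Ico 0 T).image_sub_le_mul_sub_of_deriv_le (C := ρ * ε)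
      (f := fun s => barrierLyapunov k (z s) (w s))
      (fun r hr => by
        obtain ⟨d, -, hd⟩ := hD r hr
        exact hd.continuousAt.continuousWithinAt)
      (fun r hr => by
        obtain ⟨d, -, hd⟩ := hD r (interior_subset hr)
        exact hd.differentiableAt.differentiableWithinAt)
      (fun r hr => by
        obtain ⟨d, hdle, hd⟩ := hD r (interior_subset hr)
        exact hd.deriv.trans_le hdle)
      0 ⟨le_rfl, hTpos⟩ s hs hs.1
    have h' : ρ * ε * (s - 0) ≤ ρ * ε * T :=
      mul_le_mul_of_nonneg_left (by linarith [hs.2]) (mul_nonneg hρ hε.le)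
    linarith
  have hlimit : k j ^ 2 * Real.exp (-(2 * M)) ≤ k j ^ 2 - z T j ^ 2 := by
    have hcl : IsClosed {s | k j ^ 2 * Real.exp (-(2 * M)) ≤ k j ^ 2 - z s j ^ 2} :=
      isClosed_le continuous_const (continuous_const.sub ((hzc j).pow 2))
    refine hcl.closure_subset_iff.mpr (fun s hs => ?_)
      (show T ∈ closure (Set.Ico 0 T) by
        rw [closure_Ico hTpos.ne]
        exact ⟨hT0, le_rfl⟩)
    exact exp_neg_two_mul_barrierLyapunov_le (hbefore s hs) (hbound s hs) j
  have hkj : 0 < k j := (abs_nonneg _).trans_lt (h0 j)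
  have hsq : k j ^ 2 ≤ z T j ^ 2 := sq_le_sq.mpr (by rwa [abs_of_pos hkj])
  have : 0 < k j ^ 2 * Real.exp (-(2 * M)) := by positivity
  linarith

/-- robust BLF quadrotor controller keeps position and attitude
tracking errors within the prescribed constraints. -/
theorem stmt_2 (kp kq : Fin 3 → ℝ) (hkp : ∀ i, 0 < kp i) (hkq : ∀ i, 0 < kq i)
    (γp γq : Fin 3 → ℝ) (hγp : ∀ i, 0 < γp i) (hγq : ∀ i, 0 < γq i)
    (Λ₂p Λ₂q : Matrix (Fin 3) (Fin 3) ℝ) (hΛ₂p : Λ₂p.PosDef) (hΛ₂q : Λ₂q.PosDef)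
    (ρp ρq εp εq : ℝ) (hρp : 0 ≤ ρp) (hρq : 0 ≤ ρq) (hεp : 0 < εp) (hεq : 0 < εq)
    (zp z2p zq z2q : ℝ → EuclideanSpace ℝ (Fin 3))
    (ηp ηq : ℝ → EuclideanSpace ℝ (Fin 3)) (hηpc : Continuous ηp) (hηqc : Continuous ηq)
    (hηp : ∀ t, 0 ≤ t → ‖ηp t‖ ≤ ρp) (hηq : ∀ t, 0 ≤ t → ‖ηq t‖ ≤ ρq)
    (hzp : Differentiable ℝ zp) (hz2p : Differentiable ℝ z2p)
    (hzq : Differentiable ℝ zq) (hz2q : Differentiable ℝ z2q)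
    (heqp : ∀ t, 0 ≤ t →
      deriv zp t = z2p t - Matrix.toEuclideanLin (Matrix.diagonal γp) (zp t))
    (heq2p : ∀ t, 0 ≤ t →
      deriv z2p t =
        -(Matrix.toEuclideanLin (Matrix.diagonal fun i => 1 / (kp i ^ 2 - zp t i ^ 2)) (zp t))
        - Matrix.toEuclideanLin Λ₂p (z2p t) - ρp • sat (z2p t) εp + ηp t)
    (heqq : ∀ t, 0 ≤ t →
      deriv zq t = z2q t - Matrix.toEuclideanLin (Matrix.diagonal γq) (zq t))
    (heq2q : ∀ t, 0 ≤ t →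
      deriv z2q t =
        -(Matrix.toEuclideanLin (Matrix.diagonal fun i => 1 / (kq i ^ 2 - zq t i ^ 2)) (zq t))
        - Matrix.toEuclideanLin Λ₂q (z2q t) - ρq • sat (z2q t) εq + ηq t)
    (h0p : ∀ i, |zp 0 i| < kp i) (h0q : ∀ i, |zq 0 i| < kq i) :
    ∀ t, 0 ≤ t → (∀ i, |zp t i| < kp i) ∧ (∀ i, |zq t i| < kq i) := by
  intro t ht
  exact ⟨abs_lt_of_closedLoop (fun i => (hγp i).le) hΛ₂p.posSemidef hρp hεp hηp hzp hz2p heqp heq2p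
      h0p ht,
    abs_lt_of_closedLoop (fun i => (hγq i).le) hΛ₂q.posSemidef hρq hεq hηq hzq hz2q heqq heq2q
      h0q ht⟩
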